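/- Let s = (12) and t = (23) in S₃. The multiset A = {s, s, t, t, t, t} (two copies of s and four copies of t) is not quotient-realizable in S₃. -/

import Mathlib

/-- A multiset `A` of cardinality `|G|` with elements in a finite group `G` is
quotient-realizable in `G` if there are bijections `b, c : {1,…,|G|} → G` with
`A = {b(i)·c(i)⁻¹ : 1 ≤ i ≤ |G|}` as multisets. -/
def QuotientRealizable (G : Type*) [Group G] (A : Multiset G) : Prop :=
  ∃ b c : Fin (Nat.card G) ≃ G,
    A = ↑(List.ofFn fun i => b i * (c i)⁻¹)

/-- The transposition `s = (12)` in `S₃`. -/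
def s3s : Equiv.Perm (Fin 3) := Equiv.swap 0 1

/-- The transposition `t = (23)` in `S₃`. -/
def s3t : Equiv.Perm (Fin 3) := Equiv.swap 1 2

/-- A realization of `A` amounts to a permutation `σ` of `G` whose quotients `σ g * g⁻¹` form `A`. -/
theorem QuotientRealizable.exists_perm {G : Type*} [Group G] [Fintype G] {A : Multiset G}
    (h : QuotientRealizable G A) :
    ∃ σ : Equiv.Perm G, A = (Finset.univ : Finset G).val.map fun g => σ g * g⁻¹ := by
  obtain ⟨b, c, rfl⟩ := h
  refine ⟨c.symm.trans b, ?_⟩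
  rw [← Fin.univ_val_map, ← Finset.map_univ_equiv c, Finset.map_val, Multiset.map_map]
  simp [Function.comp_def]

/-- If every quotient `σ g * g⁻¹` is `s` or `t`, the set where it equals `s` is stable under left
multiplication by `t⁻¹ * s`. -/
theorem Equiv.Perm.quotient_eq_of_quotient_eq {G : Type*} [Group G] (σ : Equiv.Perm G) {s t : G}
    (hst : s ≠ t) (hσ : ∀ g, σ g * g⁻¹ = s ∨ σ g * g⁻¹ = t) {g : G} (hg : σ g * g⁻¹ = s) :
    σ (t⁻¹ * s * g) * (t⁻¹ * s * g)⁻¹ = s := by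
  refine (hσ _).resolve_right fun h => hst ?_
  rw [mul_inv_eq_iff_eq_mul] at h hg
  have h' : t⁻¹ * s * g = g := σ.injective (by rw [h, hg]; group)
  rw [mul_eq_right, inv_mul_eq_one] at h'
  exact h'.symm

/-- The multiset `{s, s, t, t, t, t}` is not quotient-realizable in `S₃`. -/
theorem stmt11 :
    ¬ QuotientRealizable (Equiv.Perm (Fin 3))
        {s3s, s3s, s3t, s3t, s3t, s3t} := by
  intro h
  obtain ⟨σ, hA⟩ := h.exists_perm
  have hst : s3s ≠ s3t := by decide
  have hσ (g) : σ g * g⁻¹ = s3s ∨ σ g * g⁻¹ = s3t := by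
    have hg : σ g * g⁻¹ ∈ ({s3s, s3s, s3t, s3t, s3t, s3t} : Multiset (Equiv.Perm (Fin 3))) :=
      hA ▸ Multiset.mem_map_of_mem _ (Finset.mem_univ g)
    simpa using hg
  have hcount : (Finset.univ.filter fun g => s3s = σ g * g⁻¹).card = 2 := by
    have h2 := congrArg (Multiset.count s3s) hA
    rw [Multiset.count_map] at h2
    exact h2.symm.trans (by decide)
  obtain ⟨g, hg⟩ := Finset.card_pos.1 (hcount.symm ▸ Nat.two_pos)
  have hg₀ : σ g * g⁻¹ = s3s := (Finset.mem_filter.1 hg).2.symm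
  have hg₁ := σ.quotient_eq_of_quotient_eq hst hσ hg₀
  have hg₂ := σ.quotient_eq_of_quotient_eq hst hσ hg₁
  have hne : ∀ x : Equiv.Perm (Fin 3), x ≠ s3t⁻¹ * s3s * x ∧
      x ≠ s3t⁻¹ * s3s * (s3t⁻¹ * s3s * x) := by decide
  refine absurd (Finset.two_lt_card.2 ⟨g, ?_, _, ?_, _, ?_, (hne g).1, (hne g).2, (hne _).1⟩)
    hcount.le.not_gt
  · exact hg
  · exact Finset.mem_filter.2 ⟨Finset.mem_univ _, hg₁.symm⟩
  · exact Finset.mem_filter.2 ⟨Finset.mem_univ _, hg₂.symm⟩
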